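/- Weighted L² bound for ∂_z u^r: for every λ ∈ [0,1) there exists a constant C > 0, depending only on λ, such that for every t ≥ 0, every admissible g, every n ∈ ℕ, and every multi-index α with |α| = n: ‖θ_λ ⟨r⟩ⁿ ∂^α_h ∂_z u^r‖_{L²} ≤ C ( ⟨t⟩^{−1/2} ‖θ ⟨r⟩ⁿ ∂^α_h g‖_{L²} + ‖θ ⟨r⟩ⁿ ∂^α_h ∂_z g‖_{L²} ). -/

import Mathlib

open MeasureTheory Filter Set

noncomputable section

/-- `⟨t⟩ = 1 + t` -/
def angT (t : ℝ) : ℝ := 1 + t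

/-- `θ_λ(z) = exp (λ z² / (8⟨t⟩))`; `θ = θ₁`. -/
def thw (t lam z : ℝ) : ℝ := Real.exp (lam * z ^ 2 / (8 * angT t))

/-- `⟨r⟩ = √(x² + y² + 1)` -/
def angR (x y : ℝ) : ℝ := Real.sqrt (x ^ 2 + y ^ 2 + 1)

/-- `Mₙ = (n+1)⁴ / n!` -/
def Mfac (n : ℕ) : ℝ := ((n : ℝ) + 1) ^ 4 / (n.factorial : ℝ)

/-- `∂_x` -/
def pdx (f : ℝ → ℝ → ℝ → ℝ) : ℝ → ℝ → ℝ → ℝ := fun x y z => deriv (fun x' => f x' y z) x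
/-- `∂_y` -/
def pdy (f : ℝ → ℝ → ℝ → ℝ) : ℝ → ℝ → ℝ → ℝ := fun x y z => deriv (fun y' => f x y' z) y
/-- `∂_z` -/
def pdz (f : ℝ → ℝ → ℝ → ℝ) : ℝ → ℝ → ℝ → ℝ := fun x y z => deriv (fun z' => f x y z') z

/-- `∂^α_h = ∂_x^{α₁} ∂_y^{α₂}` for the multi-index `α = (a, b)` -/
def pdh (a b : ℕ) (f : ℝ → ℝ → ℝ → ℝ) : ℝ → ℝ → ℝ → ℝ := pdx^[a] (pdy^[b] f)

/-- `r ∂_r = x ∂_x + y ∂_y` -/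
def rdr (f : ℝ → ℝ → ℝ → ℝ) : ℝ → ℝ → ℝ → ℝ := fun x y z => x * pdx f x y z + y * pdy f x y z

/-- weighted `L²` norm over `ℝ² × (0,∞)` of `θ_λ ⟨r⟩ⁿ f` -/
def L2w (t lam : ℝ) (n : ℕ) (f : ℝ → ℝ → ℝ → ℝ) : ℝ :=
  Real.sqrt (∫ x : ℝ, ∫ y : ℝ, ∫ z in Ioi (0 : ℝ), (thw t lam z * angR x y ^ n * f x y z) ^ 2)

/-- weighted `L²_z` norm at fixed `(x, y)` of `θ_λ ⟨r⟩ⁿ f (x, y, ·)` -/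
def L2z (t lam : ℝ) (n : ℕ) (f : ℝ → ℝ → ℝ → ℝ) (x y : ℝ) : ℝ :=
  Real.sqrt (∫ z in Ioi (0 : ℝ), (thw t lam z * angR x y ^ n * f x y z) ^ 2)

/-- mixed `L^∞_h L²_z` norm of `θ_λ ⟨r⟩ⁿ f` -/
def LIh2z (t lam : ℝ) (n : ℕ) (f : ℝ → ℝ → ℝ → ℝ) : ℝ :=
  Real.sqrt (∫ z in Ioi (0 : ℝ), (⨆ p : ℝ × ℝ, |thw t lam z * angR p.1 p.2 ^ n * f p.1 p.2 z|) ^ 2)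

/-- mixed `L²_h L^∞_z` norm of `θ_λ ⟨r⟩ⁿ f` -/
def L2hIz (t lam : ℝ) (n : ℕ) (f : ℝ → ℝ → ℝ → ℝ) : ℝ :=
  Real.sqrt (∫ x : ℝ, ∫ y : ℝ,
    (⨆ z : Ioi (0 : ℝ), |thw t lam (z : ℝ) * angR x y ^ n * f x y (z : ℝ)|) ^ 2)

/-- the primitive `φ(x,y,z) = exp(−z²/(4⟨t⟩)) ∫₀^z g(x,y,s) exp(s²/(4⟨t⟩)) ds` -/
def phiF (t : ℝ) (g : ℝ → ℝ → ℝ → ℝ) : ℝ → ℝ → ℝ → ℝ := fun x y z =>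
  Real.exp (-(z ^ 2) / (4 * angT t)) * ∫ s in (0 : ℝ)..z, g x y s * Real.exp (s ^ 2 / (4 * angT t))

/-- `u^r = ∂_z φ` -/
def ur (t : ℝ) (g : ℝ → ℝ → ℝ → ℝ) : ℝ → ℝ → ℝ → ℝ := pdz (phiF t g)

/-- `u^z = −(x∂_x + y∂_y)φ − 2φ` -/
def uzv (t : ℝ) (g : ℝ → ℝ → ℝ → ℝ) : ℝ → ℝ → ℝ → ℝ := fun x y z =>
  -(rdr (phiF t g) x y z) - 2 * phiF t g x y z

/-- smoothness together with rapid decay in `z` of all derivatives -/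
def DecaySmooth (g : ℝ → ℝ → ℝ → ℝ) : Prop :=
  ContDiff ℝ (⊤ : ℕ∞) (fun p : ℝ × ℝ × ℝ => g p.1 p.2.1 p.2.2) ∧
  ∀ a b k m : ℕ, ∀ x y : ℝ,
    Tendsto (fun z : ℝ => z ^ m * pdz^[k] (pdh a b g) x y z) atTop (nhds 0)

/-- `θ ⟨r⟩^{|α|} ∂^α_h g ∈ L²(ℝ² × (0,∞))` for every `α` -/
def L2cond (t : ℝ) (g : ℝ → ℝ → ℝ → ℝ) : Prop :=
  ∀ a b : ℕ,
    Integrable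
      (fun p : ℝ × ℝ × ℝ =>
        (thw t 1 p.2.2 * angR p.1 p.2.1 ^ (a + b) * pdh a b g p.1 p.2.1 p.2.2) ^ 2)
      (volume.restrict {p : ℝ × ℝ × ℝ | 0 < p.2.2})

/-- `θ ⟨r⟩^{|α|} ∂^α_h ∂_z g ∈ L²(ℝ² × (0,∞))` for every `α` -/
def L2condZ (t : ℝ) (g : ℝ → ℝ → ℝ → ℝ) : Prop :=
  ∀ a b : ℕ,
    Integrable
      (fun p : ℝ × ℝ × ℝ =>
        (thw t 1 p.2.2 * angR p.1 p.2.1 ^ (a + b) * pdh a b (pdz g) p.1 p.2.1 p.2.2) ^ 2)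
      (volume.restrict {p : ℝ × ℝ × ℝ | 0 < p.2.2})

/-- `X_n(g, τ)` -/
def Xel (t τ : ℝ) (g : ℝ → ℝ → ℝ → ℝ) (n : ℕ) : ℝ :=
  (∑ a ∈ Finset.range (n + 1), L2w t 1 n (pdh a (n - a) g)) * τ ^ n * Mfac n

/-- `D_n(g, τ) = X_n(∂_z g, τ)` -/
def Del (t τ : ℝ) (g : ℝ → ℝ → ℝ → ℝ) (n : ℕ) : ℝ :=
  (∑ a ∈ Finset.range (n + 1), L2w t 1 n (pdh a (n - a) (pdz g))) * τ ^ n * Mfac n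

/-- `Y_n(g, τ)` (with `Y₀ = 0`) -/
def Yel (t τ : ℝ) (g : ℝ → ℝ → ℝ → ℝ) (n : ℕ) : ℝ :=
  (∑ a ∈ Finset.range (n + 1), L2w t 1 n (pdh a (n - a) g)) * τ ^ (n - 1) * (n : ℝ) * Mfac n

/-- `‖g‖_{X_τ}` -/
def Xnrm (t τ : ℝ) (g : ℝ → ℝ → ℝ → ℝ) : ℝ := ∑' n : ℕ, Xel t τ g n
/-- `‖g‖_{D_τ}` -/
def Dnrm (t τ : ℝ) (g : ℝ → ℝ → ℝ → ℝ) : ℝ := ∑' n : ℕ, Del t τ g n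
/-- `‖g‖_{Y_τ}` -/
def Ynrm (t τ : ℝ) (g : ℝ → ℝ → ℝ → ℝ) : ℝ := ∑' n : ℕ, Yel t τ g n

/-- triple integral over `ℝ² × (0,∞)` -/
def trip (F : ℝ → ℝ → ℝ → ℝ) : ℝ := ∫ x : ℝ, ∫ y : ℝ, ∫ z in Ioi (0 : ℝ), F x y z

/-- `I^α_1` -/
def I1 (t : ℝ) (g : ℝ → ℝ → ℝ → ℝ) (a b : ℕ) : ℝ :=
  -trip fun x y z =>
    thw t 2 z * angR x y ^ (2 * (a + b)) *
      pdh a b (fun x' y' z' => ur t g x' y' z' * rdr g x' y' z') x y z * pdh a b g x y z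

/-- `I^α_2` -/
def I2 (t : ℝ) (g : ℝ → ℝ → ℝ → ℝ) (a b : ℕ) : ℝ :=
  -trip fun x y z =>
    thw t 2 z * angR x y ^ (2 * (a + b)) *
      pdh a b (fun x' y' z' => uzv t g x' y' z' * pdz g x' y' z') x y z * pdh a b g x y z

/-- `I^α_3` -/
def I3 (t : ℝ) (g : ℝ → ℝ → ℝ → ℝ) (a b : ℕ) : ℝ :=
  -trip fun x y z =>
    thw t 2 z * angR x y ^ (2 * (a + b)) *
      pdh a b (fun x' y' z' => ur t g x' y' z' ^ 2) x y z * pdh a b g x y z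

/-- `I^α_4` -/
def I4 (t : ℝ) (g : ℝ → ℝ → ℝ → ℝ) (a b : ℕ) : ℝ :=
  (1 / (2 * angT t)) * trip fun x y z =>
    thw t 2 z * angR x y ^ (2 * (a + b)) *
      pdh a b
        (fun x' y' z' =>
          uzv t g x' y' z' * pdz (fun x'' y'' w => w * phiF t g x'' y'' w) x' y' z') x y z *
      pdh a b g x y z

/-- `I^α_5` -/
def I5 (t : ℝ) (g : ℝ → ℝ → ℝ → ℝ) (a b : ℕ) : ℝ :=
  -(1 / angT t) * trip fun x y z =>
    z * thw t 2 z * angR x y ^ (2 * (a + b)) *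
      pdh a b (fun x' y' z' => ur t g x' y' z' * phiF t g x' y' z') x y z * pdh a b g x y z

/-- `I^α_6` -/
def I6 (t : ℝ) (g : ℝ → ℝ → ℝ → ℝ) (a b : ℕ) : ℝ :=
  -(1 / (2 * angT t)) * trip fun x y z =>
    z * thw t 2 z * angR x y ^ (2 * (a + b)) *
      (∫ s in Ioi z, pdh a b (fun x' y' z' => ur t g x' y' z' ^ 2) x y s) * pdh a b g x y z

/-- `I^α_7` -/
def I7 (t : ℝ) (g : ℝ → ℝ → ℝ → ℝ) (a b : ℕ) : ℝ :=
  (1 / angT t) * trip fun x y z =>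
    z * thw t 2 z * angR x y ^ (2 * (a + b)) *
      (∫ s in Ioi z, pdh a b (fun x' y' z' => pdz (ur t g) x' y' z' * uzv t g x' y' z') x y s) *
      pdh a b g x y z

/-- `∑_{|α| = n} |I^α| τⁿ Mₙ / ‖θ ⟨r⟩ⁿ ∂^α_h g‖_{L²}` (with the convention `x / 0 = 0`) -/
def Qterm (t τ : ℝ) (g : ℝ → ℝ → ℝ → ℝ) (I : ℕ → ℕ → ℝ) (n : ℕ) : ℝ :=
  ∑ a ∈ Finset.range (n + 1), |I a (n - a)| * τ ^ n * Mfac n / L2w t 1 n (pdh a (n - a) g)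

/-- `∂_t` -/
def pdt (G : ℝ → ℝ → ℝ → ℝ → ℝ) (t x y z : ℝ) : ℝ := deriv (fun t' => G t' x y z) t

/-- the good-unknown axially symmetric Prandtl equation at the point `(t, x, y, z)` -/
def GoodEq (G : ℝ → ℝ → ℝ → ℝ → ℝ) (t x y z : ℝ) : Prop :=
  pdt G t x y z
      + ur t (G t) x y z * rdr (G t) x y z
      + uzv t (G t) x y z * pdz (G t) x y z
      - pdz (pdz (G t)) x y z
      + G t x y z / angT t
      + ur t (G t) x y z ^ 2
      - 1 / (2 * angT t) * (uzv t (G t) x y z * pdz (fun x' y' w => w * phiF t (G t) x' y' w) x y z)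
      + z / angT t * (ur t (G t) x y z * phiF t (G t) x y z)
      + z / (2 * angT t) * (∫ s in Ioi z, ur t (G t) x y s ^ 2)
      - z / angT t * (∫ s in Ioi z, pdz (ur t (G t)) x y s * uzv t (G t) x y s) = 0

/-- Joint smoothness of a function of three real variables. -/
def JointlySmooth (f : ℝ → ℝ → ℝ → ℝ) : Prop :=
  ContDiff ℝ (⊤ : ℕ∞) (fun p : ℝ × ℝ × ℝ => f p.1 p.2.1 p.2.2)

namespace JointlySmooth

variable {f : ℝ → ℝ → ℝ → ℝ}

lemma hasFDerivAt (hf : JointlySmooth f) (p : ℝ × ℝ × ℝ) :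
    HasFDerivAt (fun p : ℝ × ℝ × ℝ => f p.1 p.2.1 p.2.2)
      (fderiv ℝ (fun p : ℝ × ℝ × ℝ => f p.1 p.2.1 p.2.2) p) p :=
  (hf.differentiable (by simp) p).hasFDerivAt

lemma hasDerivAt_x (hf : JointlySmooth f) (x y z : ℝ) :
    HasDerivAt (fun x' => f x' y z)
      (fderiv ℝ (fun p : ℝ × ℝ × ℝ => f p.1 p.2.1 p.2.2) (x, y, z) (1, 0, 0)) x :=
  (hf.hasFDerivAt (x, y, z)).comp_hasDerivAt (f := fun x' : ℝ => (x', y, z)) x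
    ((hasDerivAt_id x).prodMk ((hasDerivAt_const x y).prodMk (hasDerivAt_const x z)))

lemma hasDerivAt_y (hf : JointlySmooth f) (x y z : ℝ) :
    HasDerivAt (fun y' => f x y' z)
      (fderiv ℝ (fun p : ℝ × ℝ × ℝ => f p.1 p.2.1 p.2.2) (x, y, z) (0, 1, 0)) y :=
  (hf.hasFDerivAt (x, y, z)).comp_hasDerivAt (f := fun y' : ℝ => (x, y', z)) y
    ((hasDerivAt_const y x).prodMk ((hasDerivAt_id y).prodMk (hasDerivAt_const y z)))

lemma hasDerivAt_z (hf : JointlySmooth f) (x y z : ℝ) :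
    HasDerivAt (fun z' => f x y z')
      (fderiv ℝ (fun p : ℝ × ℝ × ℝ => f p.1 p.2.1 p.2.2) (x, y, z) (0, 0, 1)) z :=
  (hf.hasFDerivAt (x, y, z)).comp_hasDerivAt (f := fun z' : ℝ => (x, y, z')) z
    ((hasDerivAt_const z x).prodMk ((hasDerivAt_const z y).prodMk (hasDerivAt_id z)))

lemma hasDerivAt_pdx (hf : JointlySmooth f) (x y z : ℝ) :
    HasDerivAt (fun x' => f x' y z) (pdx f x y z) x :=
  (hf.hasDerivAt_x x y z).differentiableAt.hasDerivAt

lemma hasDerivAt_pdy (hf : JointlySmooth f) (x y z : ℝ) :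
    HasDerivAt (fun y' => f x y' z) (pdy f x y z) y :=
  (hf.hasDerivAt_y x y z).differentiableAt.hasDerivAt

lemma hasDerivAt_pdz (hf : JointlySmooth f) (x y z : ℝ) :
    HasDerivAt (fun z' => f x y z') (pdz f x y z) z :=
  (hf.hasDerivAt_z x y z).differentiableAt.hasDerivAt

lemma contDiff_fderiv_apply (hf : JointlySmooth f) (v : ℝ × ℝ × ℝ) :
    ContDiff ℝ (⊤ : ℕ∞)
      (fun p => fderiv ℝ (fun p : ℝ × ℝ × ℝ => f p.1 p.2.1 p.2.2) p v) :=
  (ContDiff.fderiv_right (m := (⊤ : ℕ∞)) hf (by simp)).clm_apply contDiff_const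

lemma pdx (hf : JointlySmooth f) : JointlySmooth (pdx f) :=
  (congrArg (ContDiff ℝ _) (funext fun p : ℝ × ℝ × ℝ =>
    (hf.hasDerivAt_x p.1 p.2.1 p.2.2).deriv)).mpr (hf.contDiff_fderiv_apply (1, 0, 0))

lemma pdy (hf : JointlySmooth f) : JointlySmooth (pdy f) :=
  (congrArg (ContDiff ℝ _) (funext fun p : ℝ × ℝ × ℝ =>
    (hf.hasDerivAt_y p.1 p.2.1 p.2.2).deriv)).mpr (hf.contDiff_fderiv_apply (0, 1, 0))

lemma pdz (hf : JointlySmooth f) : JointlySmooth (pdz f) :=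
  (congrArg (ContDiff ℝ _) (funext fun p : ℝ × ℝ × ℝ =>
    (hf.hasDerivAt_z p.1 p.2.1 p.2.2).deriv)).mpr (hf.contDiff_fderiv_apply (0, 0, 1))

lemma iterate_pdx (hf : JointlySmooth f) (a : ℕ) : JointlySmooth (_root_.pdx^[a] f) := by
  induction a with
  | zero => exact hf
  | succ a ih => rw [Function.iterate_succ_apply']; exact ih.pdx

lemma iterate_pdy (hf : JointlySmooth f) (b : ℕ) : JointlySmooth (_root_.pdy^[b] f) := by
  induction b with
  | zero => exact hf
  | succ b ih => rw [Function.iterate_succ_apply']; exact ih.pdy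

lemma pdh (hf : JointlySmooth f) (a b : ℕ) : JointlySmooth (pdh a b f) :=
  (hf.iterate_pdy b).iterate_pdx a

lemma continuous_comp (hf : JointlySmooth f) {X : Type*} [TopologicalSpace X] {u v w : X → ℝ}
    (hu : Continuous u) (hv : Continuous v) (hw : Continuous w) :
    Continuous fun p => f (u p) (v p) (w p) :=
  hf.continuous.comp (hu.prodMk (hv.prodMk hw))

end JointlySmooth

lemma hasDerivAt_intervalIntegral_of_continuous {F F' : ℝ → ℝ → ℝ}
    (hF : Continuous (Function.uncurry F)) (hF' : Continuous (Function.uncurry F'))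
    (hd : ∀ x s, HasDerivAt (fun x' => F x' s) (F' x s) x) (a b x₀ : ℝ) :
    HasDerivAt (fun x => ∫ s in a..b, F x s) (∫ s in a..b, F' x₀ s) x₀ := by
  obtain ⟨M, hM⟩ := ((isCompact_closedBall x₀ 1).prod
    (isCompact_uIcc (a := a) (b := b))).exists_bound_of_continuousOn hF'.continuousOn
  have hc : ∀ x, Continuous (F x) := fun x => hF.comp (Continuous.prodMk_right x)
  have hc' : ∀ x, Continuous (F' x) := fun x => hF'.comp (Continuous.prodMk_right x)
  refine (intervalIntegral.hasDerivAt_integral_of_dominated_loc_of_deriv_le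
    (bound := fun _ => M) (Metric.closedBall_mem_nhds x₀ one_pos)
    (Eventually.of_forall fun x => (hc x).aestronglyMeasurable)
    ((hc x₀).intervalIntegrable a b) (hc' x₀).aestronglyMeasurable
    (Eventually.of_forall fun s hs x hx => hM (x, s) ⟨hx, uIoc_subset_uIcc hs⟩)
    intervalIntegrable_const (Eventually.of_forall fun s _ x _ => hd x s)).2

lemma hasDerivAt_phiF_x {g : ℝ → ℝ → ℝ → ℝ} (hg : JointlySmooth g) (t x y z : ℝ) :
    HasDerivAt (fun x' => phiF t g x' y z) (phiF t (pdx g) x y z) x := by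
  refine (hasDerivAt_intervalIntegral_of_continuous
    (F := fun x s => g x y s * Real.exp (s ^ 2 / (4 * angT t)))
    (F' := fun x s => pdx g x y s * Real.exp (s ^ 2 / (4 * angT t))) ?_ ?_
    (fun x s => (hg.hasDerivAt_pdx x y s).mul_const _) 0 z x).const_mul _
  · exact (hg.continuous_comp continuous_fst continuous_const continuous_snd).mul (by fun_prop)
  · exact (hg.pdx.continuous_comp continuous_fst continuous_const continuous_snd).mul
      (by fun_prop)

lemma hasDerivAt_phiF_y {g : ℝ → ℝ → ℝ → ℝ} (hg : JointlySmooth g) (t x y z : ℝ) :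
    HasDerivAt (fun y' => phiF t g x y' z) (phiF t (pdy g) x y z) y := by
  refine (hasDerivAt_intervalIntegral_of_continuous
    (F := fun y s => g x y s * Real.exp (s ^ 2 / (4 * angT t)))
    (F' := fun y s => pdy g x y s * Real.exp (s ^ 2 / (4 * angT t))) ?_ ?_
    (fun y s => (hg.hasDerivAt_pdy x y s).mul_const _) 0 z y).const_mul _
  · exact (hg.continuous_comp continuous_const continuous_fst continuous_snd).mul (by fun_prop)
  · exact (hg.pdy.continuous_comp continuous_const continuous_fst continuous_snd).mul
      (by fun_prop)

lemma hasDerivAt_phiF_z {g : ℝ → ℝ → ℝ → ℝ} (hg : JointlySmooth g) {t : ℝ} (ht : 0 < angT t)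
    (x y z : ℝ) :
    HasDerivAt (fun z' => phiF t g x y z')
      (g x y z - z / (2 * angT t) * phiF t g x y z) z := by
  have hc : Continuous fun s => g x y s * Real.exp (s ^ 2 / (4 * angT t)) :=
    (hg.continuous_comp continuous_const continuous_const continuous_id).mul (by fun_prop)
  have hI := intervalIntegral.integral_hasDerivAt_right (hc.intervalIntegrable 0 z)
    hc.stronglyMeasurable.stronglyMeasurableAtFilter hc.continuousAt
  have hE : HasDerivAt (fun z' : ℝ => Real.exp (-(z' ^ 2) / (4 * angT t)))
      (Real.exp (-(z ^ 2) / (4 * angT t)) * (-(2 * z) / (4 * angT t))) z := by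
    simpa using (((hasDerivAt_pow 2 z).neg.div_const (4 * angT t)).exp)
  refine (hE.mul hI).congr_deriv ?_
  have he : Real.exp (-(z ^ 2) / (4 * angT t)) * Real.exp (z ^ 2 / (4 * angT t)) = 1 := by
    rw [← Real.exp_add, neg_div, neg_add_cancel, Real.exp_zero]
  have hz : -(2 * z) / (4 * angT t) = -(z / (2 * angT t)) := by field_simp; ring
  rw [hz, phiF]
  linear_combination g x y z * he

/-- The expression of `∂_z u^r` in terms of `A = ∂_z g`, `B = C = g`. -/
def dzurForm (t : ℝ) (A B C : ℝ → ℝ → ℝ → ℝ) : ℝ → ℝ → ℝ → ℝ := fun x y z =>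
  A x y z - z / (2 * angT t) * B x y z +
    ((z / (2 * angT t)) ^ 2 - 1 / (2 * angT t)) * phiF t C x y z

lemma pdz_ur_eq {g : ℝ → ℝ → ℝ → ℝ} (hg : JointlySmooth g) {t : ℝ} (ht : 0 < angT t) :
    pdz (ur t g) = dzurForm t (pdz g) g g := by
  have hur : ur t g = fun x y z => g x y z - z / (2 * angT t) * phiF t g x y z := by
    funext x y z; exact (hasDerivAt_phiF_z hg ht x y z).deriv
  rw [hur]
  funext x y z
  refine ((hg.hasDerivAt_pdz x y z).sub
    (((hasDerivAt_id' z).div_const (2 * angT t)).mul (hasDerivAt_phiF_z hg ht x y z))).deriv.trans ?_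
  simp only [dzurForm]
  ring

section

variable {A B C : ℝ → ℝ → ℝ → ℝ} (t : ℝ)

lemma pdx_dzurForm (hA : JointlySmooth A) (hB : JointlySmooth B) (hC : JointlySmooth C) :
    pdx (dzurForm t A B C) = dzurForm t (pdx A) (pdx B) (pdx C) := by
  funext x y z
  exact (((hA.hasDerivAt_pdx x y z).sub ((hB.hasDerivAt_pdx x y z).const_mul _)).add
    ((hasDerivAt_phiF_x hC t x y z).const_mul _)).deriv

lemma pdy_dzurForm (hA : JointlySmooth A) (hB : JointlySmooth B) (hC : JointlySmooth C) :
    pdy (dzurForm t A B C) = dzurForm t (pdy A) (pdy B) (pdy C) := by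
  funext x y z
  exact (((hA.hasDerivAt_pdy x y z).sub ((hB.hasDerivAt_pdy x y z).const_mul _)).add
    ((hasDerivAt_phiF_y hC t x y z).const_mul _)).deriv

lemma pdh_dzurForm (hA : JointlySmooth A) (hB : JointlySmooth B) (hC : JointlySmooth C)
    (a b : ℕ) :
    pdh a b (dzurForm t A B C) = dzurForm t (pdh a b A) (pdh a b B) (pdh a b C) := by
  have hy : pdy^[b] (dzurForm t A B C) = dzurForm t (pdy^[b] A) (pdy^[b] B) (pdy^[b] C) := by
    induction b with
    | zero => rfl
    | succ b ih =>
      simp only [Function.iterate_succ_apply', ih]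
      exact pdy_dzurForm t (hA.iterate_pdy b) (hB.iterate_pdy b) (hC.iterate_pdy b)
  simp only [pdh, hy]
  induction a with
  | zero => rfl
  | succ a ih =>
    simp only [Function.iterate_succ_apply', ih]
    exact pdx_dzurForm t ((hA.iterate_pdy b).iterate_pdx a) ((hB.iterate_pdy b).iterate_pdx a)
      ((hC.iterate_pdy b).iterate_pdx a)

end

lemma sq_intervalIntegral_le {f : ℝ → ℝ} (hf : Continuous f) {z : ℝ} (hz : 0 < z) :
    (∫ s in (0 : ℝ)..z, f s) ^ 2 ≤ z * ∫ s in (0 : ℝ)..z, f s ^ 2 := by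
  set I := ∫ s in (0 : ℝ)..z, f s with hI
  have h0 : 0 ≤ ∫ s in (0 : ℝ)..z, (f s - I / z) ^ 2 :=
    intervalIntegral.integral_nonneg hz.le fun s _ => sq_nonneg _
  have h1 : ∫ s in (0 : ℝ)..z, (f s - I / z) ^ 2
      = (∫ s in (0 : ℝ)..z, f s ^ 2) - 2 * (I / z) * I + (I / z) ^ 2 * z := by
    have : ∀ s, (f s - I / z) ^ 2 = f s ^ 2 - 2 * (I / z) * f s + (I / z) ^ 2 := fun s => by ring
    simp only [this]
    rw [intervalIntegral.integral_add
        (Continuous.intervalIntegrable (by fun_prop) _ _) intervalIntegrable_const,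
      intervalIntegral.integral_sub (Continuous.intervalIntegrable (by fun_prop) _ _)
        (Continuous.intervalIntegrable (by fun_prop) _ _),
      intervalIntegral.integral_const_mul, intervalIntegral.integral_const, ← hI]
    simp [mul_comm]
  rw [h1] at h0
  have h2 : (∫ s in (0 : ℝ)..z, f s ^ 2) - 2 * (I / z) * I + (I / z) ^ 2 * z
      = ((∫ s in (0 : ℝ)..z, f s ^ 2) * z - I ^ 2) / z := by
    field_simp; ring
  rw [h2, div_nonneg_iff] at h0
  rcases h0 with h0 | h0 <;> nlinarith

lemma integral_mul_exp_neg_mul_sq_Ioi {b : ℝ} (hb : 0 < b) :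
    ∫ r in Ioi (0 : ℝ), r * Real.exp (-b * r ^ 2) = (2 * b)⁻¹ := by
  have h := integral_mul_cexp_neg_mul_sq (b := (b : ℂ)) (by simpa using hb)
  exact_mod_cast h

/-- Pointwise weighted bound for `φ` by the weighted `L²_z` norm of `g`. -/
lemma sq_mul_phiF_le {g : ℝ → ℝ → ℝ → ℝ} (hg : JointlySmooth g) {t : ℝ} (ht : 0 < angT t)
    (R x y : ℝ) {z : ℝ} (hz : 0 < z)
    (hi : IntegrableOn (fun s => (thw t 1 s * R * g x y s) ^ 2) (Ioi 0)) :
    (R * phiF t g x y z) ^ 2 ≤ z * Real.exp (-(z ^ 2) / (4 * angT t)) *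
      ∫ s in Ioi (0 : ℝ), (thw t 1 s * R * g x y s) ^ 2 := by
  have hgc : Continuous (g x y) :=
    hg.continuous_comp continuous_const continuous_const continuous_id
  have hc : Continuous fun s => R * (g x y s * Real.exp (s ^ 2 / (4 * angT t))) := by fun_prop
  have hθ : Continuous fun s => (thw t 1 s * R * g x y s) ^ 2 := by
    unfold thw; fun_prop
  set E := Real.exp (z ^ 2 / (4 * angT t))
  have hE : Real.exp (-(z ^ 2) / (4 * angT t)) = E⁻¹ := by rw [neg_div, Real.exp_neg]
  have hE0 : 0 < E := Real.exp_pos _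
  have h1 := sq_intervalIntegral_le hc hz
  rw [intervalIntegral.integral_const_mul] at h1
  have h2 : ∫ s in (0 : ℝ)..z, (R * (g x y s * Real.exp (s ^ 2 / (4 * angT t)))) ^ 2
      ≤ ∫ s in (0 : ℝ)..z, E * (thw t 1 s * R * g x y s) ^ 2 := by
    refine intervalIntegral.integral_mono_on hz.le
      ((hc.pow 2).intervalIntegrable _ _) ((hθ.const_mul E).intervalIntegrable _ _) fun s hs => ?_
    have e1 : Real.exp (s ^ 2 / (4 * angT t)) = thw t 1 s ^ 2 := by
      rw [thw, ← Real.exp_nat_mul]; congr 1; push_cast; field_simp; ring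
    have e2 : Real.exp (s ^ 2 / (4 * angT t)) ≤ E := by
      apply Real.exp_le_exp.2
      have := pow_le_pow_left₀ hs.1 hs.2 2
      gcongr
    calc (R * (g x y s * Real.exp (s ^ 2 / (4 * angT t)))) ^ 2
        = Real.exp (s ^ 2 / (4 * angT t)) * (thw t 1 s * R * g x y s) ^ 2 := by
          rw [e1]; ring
      _ ≤ E * (thw t 1 s * R * g x y s) ^ 2 := by gcongr
  rw [intervalIntegral.integral_const_mul] at h2
  have h3 : ∫ s in (0 : ℝ)..z, (thw t 1 s * R * g x y s) ^ 2
      ≤ ∫ s in Ioi (0 : ℝ), (thw t 1 s * R * g x y s) ^ 2 := by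
    rw [intervalIntegral.integral_of_le hz.le]
    exact setIntegral_mono_set hi (Eventually.of_forall fun s => sq_nonneg _)
      (Eventually.of_forall Ioc_subset_Ioi_self)
  rw [phiF, hE]
  calc (R * (E⁻¹ * ∫ s in (0 : ℝ)..z, g x y s * Real.exp (s ^ 2 / (4 * angT t)))) ^ 2
      = E⁻¹ ^ 2 * (R * ∫ s in (0 : ℝ)..z, g x y s * Real.exp (s ^ 2 / (4 * angT t))) ^ 2 := by
        ring
    _ ≤ E⁻¹ ^ 2 * (z * (E * ∫ s in Ioi (0 : ℝ), (thw t 1 s * R * g x y s) ^ 2)) := by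
        gcongr
        exact h1.trans (by gcongr; exact h2.trans (by gcongr))
    _ = _ := by
        generalize (∫ s in Ioi (0 : ℝ), (thw t 1 s * R * g x y s) ^ 2) = N
        field_simp

lemma thw_sq_eq (t lam z : ℝ) :
    thw t lam z ^ 2 = thw t 1 z ^ 2 * Real.exp (-(1 - lam) * z ^ 2 / (4 * angT t)) := by
  simp only [thw, ← Real.exp_nat_mul, ← Real.exp_add]
  congr 1; push_cast; ring

lemma mul_exp_neg_le_one (v : ℝ) : v * Real.exp (-v) ≤ 1 := by
  have h := Real.add_one_le_exp v
  have h2 : Real.exp v * Real.exp (-v) = 1 := by rw [← Real.exp_add]; simp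
  have := Real.exp_pos (-v)
  nlinarith

lemma sq_mul_exp_neg_le {T δ : ℝ} (hT : 0 < T) (hδ : 0 < δ) (z : ℝ) :
    (z / (2 * T)) ^ 2 * Real.exp (-δ * z ^ 2 / (4 * T)) ≤ 1 / (δ * T) := by
  have h := mul_exp_neg_le_one (δ * z ^ 2 / (4 * T))
  have e : -δ * z ^ 2 / (4 * T) = -(δ * z ^ 2 / (4 * T)) := by ring
  rw [e, le_div_iff₀ (by positivity)]
  refine le_trans (le_of_eq ?_) h
  field_simp; ring

lemma coeff_sq_mul_exp_neg_le {T δ : ℝ} (hT : 0 < T) (hδ : 0 < δ) (hδ1 : δ ≤ 1) (z : ℝ) :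
    ((z / (2 * T)) ^ 2 - 1 / (2 * T)) ^ 2 * Real.exp (-δ * z ^ 2 / (4 * T))
      ≤ 25 / (δ ^ 2 * T ^ 2) * Real.exp (-(δ / (8 * T)) * z ^ 2) := by
  set v := δ * z ^ 2 / (16 * T) with hv
  have hv0 : 0 ≤ v := by positivity
  have e1 : Real.exp (-δ * z ^ 2 / (4 * T))
      = Real.exp (-v) ^ 2 * Real.exp (-(δ / (8 * T)) * z ^ 2) := by
    rw [← Real.exp_nat_mul, ← Real.exp_add]; congr 1; rw [hv]; push_cast; field_simp; ring
  have h1 := mul_exp_neg_le_one v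
  have h2 : Real.exp (-v) ≤ 1 := Real.exp_le_one_iff.2 (by linarith)
  have h3 := Real.exp_pos (-v)
  have e2 : (z / (2 * T)) ^ 2 - 1 / (2 * T) = (4 * v - δ / 2) / (δ * T) := by
    rw [hv]; field_simp; ring
  have h4 : ((4 * v - δ / 2) * Real.exp (-v)) ^ 2 ≤ 25 := by
    have ha : 0 ≤ v * Real.exp (-v) := by positivity
    have hb : δ * Real.exp (-v) ≤ 1 := mul_le_one₀ hδ1 h3.le h2
    have hc : 0 ≤ δ * Real.exp (-v) := by positivity
    have h5 : |(4 * v - δ / 2) * Real.exp (-v)| ≤ 5 := abs_le.2 ⟨by nlinarith, by nlinarith⟩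
    nlinarith [sq_abs ((4 * v - δ / 2) * Real.exp (-v)), abs_nonneg ((4 * v - δ / 2) * Real.exp (-v))]
  rw [e1, e2, ← mul_assoc]
  gcongr
  rw [le_div_iff₀ (by positivity)]
  refine le_trans (le_of_eq ?_) h4
  field_simp

/-- The weighted bound at fixed horizontal position. -/
lemma integral_sq_dzurForm_le {g h : ℝ → ℝ → ℝ → ℝ} (hg : JointlySmooth g) {t lam : ℝ}
    (ht : 0 < angT t) (h0 : 0 ≤ lam) (h1 : lam < 1) (R x y : ℝ)
    (hi : IntegrableOn (fun s => (thw t 1 s * R * g x y s) ^ 2) (Ioi 0))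
    (hi' : IntegrableOn (fun s => (thw t 1 s * R * h x y s) ^ 2) (Ioi 0)) :
    ∫ z in Ioi (0 : ℝ), (thw t lam z * R * dzurForm t h g g x y z) ^ 2 ≤
      303 / (1 - lam) ^ 3 * ((angT t)⁻¹ * (∫ z in Ioi (0 : ℝ), (thw t 1 z * R * g x y z) ^ 2) +
        ∫ z in Ioi (0 : ℝ), (thw t 1 z * R * h x y z) ^ 2) := by
  set T := angT t
  set δ := 1 - lam with hδd
  have hδ : 0 < δ := by linarith
  have hδ1 : δ ≤ 1 := by linarith
  set N := ∫ z in Ioi (0 : ℝ), (thw t 1 z * R * g x y z) ^ 2 with hN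
  have hN0 : 0 ≤ N := integral_nonneg fun _ => sq_nonneg _
  set P := ∫ z in Ioi (0 : ℝ), (thw t 1 z * R * h x y z) ^ 2 with hP
  have hP0 : 0 ≤ P := integral_nonneg fun _ => sq_nonneg _
  have hb : 0 < δ / (8 * T) := by positivity
  have hk := (integrable_mul_exp_neg_mul_sq hb).integrableOn (s := Ioi (0 : ℝ))
  have i1 := hi'.const_mul 3
  have i2 := hi.const_mul (3 / (δ * T))
  have i3 := hk.const_mul (75 / (δ ^ 2 * T ^ 2) * N)
  have i12 : Integrable (fun z => 3 * (thw t 1 z * R * h x y z) ^ 2 +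
      3 / (δ * T) * (thw t 1 z * R * g x y z) ^ 2) (volume.restrict (Ioi 0)) := i1.add i2
  have key : ∫ z in Ioi (0 : ℝ), (thw t lam z * R * dzurForm t h g g x y z) ^ 2 ≤
      ∫ z in Ioi (0 : ℝ), ((3 * (thw t 1 z * R * h x y z) ^ 2 +
        3 / (δ * T) * (thw t 1 z * R * g x y z) ^ 2) +
        75 / (δ ^ 2 * T ^ 2) * N * (z * Real.exp (-(δ / (8 * T)) * z ^ 2))) := by
    refine integral_mono_of_nonneg (Eventually.of_forall fun _ => sq_nonneg _)
      (i12.add i3) ?_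
    refine (ae_restrict_iff' measurableSet_Ioi).2 (Eventually.of_forall fun z hz => ?_)
    have hz : 0 < z := hz
    set e := Real.exp (-δ * z ^ 2 / (4 * T)) with he
    have he0 : 0 < e := Real.exp_pos _
    have he1 : e ≤ 1 := Real.exp_le_one_iff.2
      (div_nonpos_of_nonpos_of_nonneg (by nlinarith [sq_nonneg z]) (by positivity))
    have hth : thw t lam z ^ 2 = thw t 1 z ^ 2 * e := thw_sq_eq t lam z
    have hth1 : thw t 1 z ^ 2 * Real.exp (-(z ^ 2) / (4 * T)) = 1 := by
      change Real.exp (1 * z ^ 2 / (8 * T)) ^ 2 * _ = 1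
      rw [← Real.exp_nat_mul, ← Real.exp_add, Real.exp_eq_one_iff]
      push_cast; field_simp; ring
    have b1 := sq_mul_exp_neg_le ht hδ z
    have b2 := coeff_sq_mul_exp_neg_le ht hδ hδ1 z
    have b3 := sq_mul_phiF_le hg ht R x y hz hi
    rw [← he] at b1 b2
    set c := z / (2 * T)
    set d := c ^ 2 - 1 / (2 * T)
    set Φ := phiF t g x y z
    have hform : dzurForm t h g g x y z = h x y z - c * g x y z + d * Φ := rfl
    have tri : (thw t lam z * R * dzurForm t h g g x y z) ^ 2 ≤
        3 * ((thw t lam z * R * h x y z) ^ 2 + (thw t lam z * R * (c * g x y z)) ^ 2 +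
          (thw t lam z * R * (d * Φ)) ^ 2) := by
      rw [hform]
      have : ∀ p q r : ℝ, (p - q + r) ^ 2 ≤ 3 * (p ^ 2 + q ^ 2 + r ^ 2) := fun p q r => by
        nlinarith [sq_nonneg (p + q), sq_nonneg (p - r), sq_nonneg (q + r)]
      refine le_trans (le_of_eq ?_) (this _ _ _)
      ring
    have t1 : (thw t lam z * R * h x y z) ^ 2 ≤ (thw t 1 z * R * h x y z) ^ 2 := by
      calc _ = (thw t 1 z * R * h x y z) ^ 2 * e := by
            rw [mul_pow, mul_pow, hth]; ring
        _ ≤ _ := mul_le_of_le_one_right (sq_nonneg _) he1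
    have t2 : (thw t lam z * R * (c * g x y z)) ^ 2 ≤
        1 / (δ * T) * (thw t 1 z * R * g x y z) ^ 2 := by
      calc _ = (c ^ 2 * e) * (thw t 1 z * R * g x y z) ^ 2 := by
            rw [mul_pow, mul_pow, hth]; ring
        _ ≤ _ := by gcongr
    have t3 : (thw t lam z * R * (d * Φ)) ^ 2 ≤
        25 / (δ ^ 2 * T ^ 2) * N * (z * Real.exp (-(δ / (8 * T)) * z ^ 2)) := by
      calc _ = (d ^ 2 * e) * (thw t 1 z ^ 2 * (R * Φ) ^ 2) := by
            rw [mul_pow, mul_pow, hth]; ring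
        _ ≤ (25 / (δ ^ 2 * T ^ 2) * Real.exp (-(δ / (8 * T)) * z ^ 2)) *
            (thw t 1 z ^ 2 * (z * Real.exp (-(z ^ 2) / (4 * T)) * N)) := by gcongr
        _ = 25 / (δ ^ 2 * T ^ 2) * Real.exp (-(δ / (8 * T)) * z ^ 2) *
            (z * N) * (thw t 1 z ^ 2 * Real.exp (-(z ^ 2) / (4 * T))) := by ring
        _ = _ := by rw [hth1]; ring
    calc _ ≤ _ := tri
      _ ≤ 3 * ((thw t 1 z * R * h x y z) ^ 2 + 1 / (δ * T) * (thw t 1 z * R * g x y z) ^ 2 +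
          25 / (δ ^ 2 * T ^ 2) * N * (z * Real.exp (-(δ / (8 * T)) * z ^ 2))) := by gcongr
      _ = _ := by ring
  rw [integral_add i12 i3, integral_add i1 i2, integral_const_mul, integral_const_mul,
    integral_const_mul, integral_mul_exp_neg_mul_sq_Ioi hb, ← hN, ← hP] at key
  refine key.trans ?_
  have hδ2 : δ ^ 3 ≤ δ := pow_le_of_le_one hδ.le hδ1 (by norm_num)
  have hδ3 : δ ^ 3 ≤ 1 := pow_le_one₀ hδ.le hδ1
  have q1 : (3 : ℝ) ≤ 303 / δ ^ 3 := by
    rw [le_div_iff₀ (by positivity)]; linarith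
  have q2 : 3 / δ + 300 / δ ^ 3 ≤ 303 / δ ^ 3 := by
    have : 3 / δ ≤ 3 / δ ^ 3 := by gcongr
    calc _ ≤ 3 / δ ^ 3 + 300 / δ ^ 3 := by gcongr
      _ = _ := by ring
  calc _ = 3 * P + (3 / δ + 300 / δ ^ 3) * (T⁻¹ * N) := by field_simp; ring
    _ ≤ 303 / δ ^ 3 * P + 303 / δ ^ 3 * (T⁻¹ * N) := by gcongr
    _ = _ := by ring

lemma integrable_slices {f : ℝ × ℝ × ℝ → ℝ}
    (hf : Integrable f (volume.restrict {p : ℝ × ℝ × ℝ | 0 < p.2.2})) :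
    (∀ᵐ x : ℝ, ∀ᵐ y : ℝ, IntegrableOn (fun z => f (x, y, z)) (Ioi 0)) ∧
    (∀ᵐ x : ℝ, Integrable fun y : ℝ => ∫ z in Ioi (0 : ℝ), f (x, y, z)) ∧
    Integrable fun x : ℝ => ∫ y : ℝ, ∫ z in Ioi (0 : ℝ), f (x, y, z) := by
  have hm : (volume : Measure (ℝ × ℝ × ℝ)).restrict {p | 0 < p.2.2} =
      (volume : Measure ℝ).prod
        ((volume : Measure ℝ).prod ((volume : Measure ℝ).restrict (Ioi 0))) := by
    have hs : {p : ℝ × ℝ × ℝ | 0 < p.2.2} = univ ×ˢ (univ ×ˢ Ioi (0 : ℝ)) := by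
      ext p; simp
    rw [hs, Measure.volume_eq_prod, Measure.volume_eq_prod, ← Measure.prod_restrict,
      ← Measure.prod_restrict, Measure.restrict_univ]
  rw [hm] at hf
  have hx := hf.prod_right_ae
  refine ⟨hx.mono fun x h => h.prod_right_ae, hx.mono fun x h => h.integral_prod_left, ?_⟩
  refine hf.integral_prod_left.congr (hx.mono fun x h => ?_)
  exact integral_prod _ h

lemma L2w_nonneg (t lam : ℝ) (n : ℕ) (f : ℝ → ℝ → ℝ → ℝ) : 0 ≤ L2w t lam n f :=
  Real.sqrt_nonneg _

lemma L2w_sq (t lam : ℝ) (n : ℕ) (f : ℝ → ℝ → ℝ → ℝ) :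
    L2w t lam n f ^ 2 =
      ∫ x : ℝ, ∫ y : ℝ, ∫ z in Ioi (0 : ℝ), (thw t lam z * angR x y ^ n * f x y z) ^ 2 :=
  Real.sq_sqrt (integral_nonneg fun _ => integral_nonneg fun _ => integral_nonneg fun _ =>
    sq_nonneg _)

lemma L2w_sq_dzurForm_le {g h : ℝ → ℝ → ℝ → ℝ} (hg : JointlySmooth g) {t lam : ℝ}
    (ht : 0 < angT t) (h0 : 0 ≤ lam) (h1 : lam < 1) (n : ℕ)
    (hi : Integrable (fun p : ℝ × ℝ × ℝ =>
      (thw t 1 p.2.2 * angR p.1 p.2.1 ^ n * g p.1 p.2.1 p.2.2) ^ 2)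
      (volume.restrict {p : ℝ × ℝ × ℝ | 0 < p.2.2}))
    (hi' : Integrable (fun p : ℝ × ℝ × ℝ =>
      (thw t 1 p.2.2 * angR p.1 p.2.1 ^ n * h p.1 p.2.1 p.2.2) ^ 2)
      (volume.restrict {p : ℝ × ℝ × ℝ | 0 < p.2.2})) :
    L2w t lam n (dzurForm t h g g) ^ 2 ≤
      303 / (1 - lam) ^ 3 * ((angT t)⁻¹ * L2w t 1 n g ^ 2 + L2w t 1 n h ^ 2) := by
  obtain ⟨a1, a2, a3⟩ := integrable_slices hi
  obtain ⟨b1, b2, b3⟩ := integrable_slices hi'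
  simp only [L2w_sq]
  rw [← integral_const_mul, ← integral_add (a3.const_mul _) b3, ← integral_const_mul]
  refine integral_mono_of_nonneg
    (Eventually.of_forall fun _ => integral_nonneg fun _ => integral_nonneg fun _ => sq_nonneg _)
    (((a3.const_mul _).add b3).const_mul _) ?_
  filter_upwards [a1, a2, b1, b2] with x a1 a2 b1 b2
  rw [← integral_const_mul, ← integral_add (a2.const_mul _) b2, ← integral_const_mul]
  refine integral_mono_of_nonneg
    (Eventually.of_forall fun _ => integral_nonneg fun _ => sq_nonneg _)
    (((a2.const_mul _).add b2).const_mul _) ?_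
  filter_upwards [a1, b1] with y a1 b1
  exact integral_sq_dzurForm_le hg ht h0 h1 _ x y a1 b1

/-- weighted `L²` bound for `∂_z u^r`. -/
theorem L2_bound_dz_ur :
    ∀ lam : ℝ, 0 ≤ lam → lam < 1 → ∃ C : ℝ, 0 < C ∧
      ∀ t : ℝ, 0 ≤ t → ∀ g : ℝ → ℝ → ℝ → ℝ, DecaySmooth g → L2cond t g → L2condZ t g →
        ∀ n a b : ℕ, a + b = n →
          L2w t lam n (pdh a b (pdz (ur t g))) ≤
            C * (angT t ^ (-(1 : ℝ) / 2) * L2w t 1 n (pdh a b g) +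
              L2w t 1 n (pdh a b (pdz g))) := by
  intro lam h0 h1
  have hδ : 0 < 1 - lam := by linarith
  have hδ3 : (1 - lam) ^ 3 ≤ 1 := pow_le_one₀ hδ.le (by linarith)
  refine ⟨303 / (1 - lam) ^ 3, by positivity, ?_⟩
  rintro t ht g ⟨hg : JointlySmooth g, -⟩ hL hLz n a b rfl
  have hT : 0 < angT t := by unfold angT; linarith
  set K := 303 / (1 - lam) ^ 3
  have hK : 1 ≤ K := by rw [le_div_iff₀ (by positivity)]; linarith
  rw [pdz_ur_eq hg hT, pdh_dzurForm t hg.pdz hg hg]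
  have key := L2w_sq_dzurForm_le (hg.pdh a b) hT h0 h1 (a + b) (hL a b) (hLz a b)
  set X := L2w t 1 (a + b) (pdh a b g)
  set Y := L2w t 1 (a + b) (pdh a b (pdz g))
  have hX : 0 ≤ X := L2w_nonneg _ _ _ _
  have hY : 0 ≤ Y := L2w_nonneg _ _ _ _
  set s := angT t ^ (-(1 : ℝ) / 2)
  have hs : 0 ≤ s := Real.rpow_nonneg hT.le _
  have hs2 : s ^ 2 = (angT t)⁻¹ := by
    rw [← Real.rpow_natCast, ← Real.rpow_mul hT.le, ← Real.rpow_neg_one]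
    norm_num
  refine le_trans (le_abs_self _) (abs_le_of_sq_le_sq (key.trans ?_) (by positivity))
  rw [← hs2]
  calc K * (s ^ 2 * X ^ 2 + Y ^ 2) ≤ K * (s * X + Y) ^ 2 := by
        gcongr
        nlinarith [mul_nonneg (mul_nonneg hs hX) hY]
    _ ≤ K ^ 2 * (s * X + Y) ^ 2 := by
        gcongr
        exact le_self_pow₀ hK (by norm_num)
    _ = (K * (s * X + Y)) ^ 2 := by ring
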